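/- Suppose the pair predictor p̂₂ is pair-calibrated with grouping function Φ, and let (Ω, P), X, Ỹ, A be as in the conditional-independence setup. Then for every β ∈ (0,1): P[ |p̂₁(Ỹ|X) − p(Ỹ|X)| > sqrt(V̂(Ỹ|X)/β) | A ] ≤ β. -/

import Mathlib

open Finset

open scoped Classical

/-- Conditional expectation of `f(X)` given `X ∈ [x]_Φ`, where `X ∼ μ` on a finite set. -/
noncomputable def groupExp {𝒳 𝒵 : Type*} [Fintype 𝒳] (μ : 𝒳 → ℝ) (Φ : 𝒳 → 𝒵)
    (f : 𝒳 → ℝ) (x : 𝒳) : ℝ :=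
  (∑ x' : 𝒳, if Φ x' = Φ x then μ x' * f x' else 0) /
  (∑ x' : 𝒳, if Φ x' = Φ x then μ x' else 0)

/-- Marginal `p̂₁(y|x) = ∑_{y'} p̂₂(y,y'|x)` of a pair predictor. -/
noncomputable def marginal {𝒳 𝒴 : Type*} [Fintype 𝒴] (p2 : 𝒳 → 𝒴 → 𝒴 → ℝ) (x : 𝒳) (y : 𝒴) : ℝ :=
  ∑ y' : 𝒴, p2 x y y'

/-- Cheat-corrected epistemic variance `V̂(y|x) = p̂₂(y,y|x) − p̂₁(y|x)²`. -/
noncomputable def cheatVar {𝒳 𝒴 : Type*} [Fintype 𝒴] (p2 : 𝒳 → 𝒴 → 𝒴 → ℝ) (x : 𝒳) (y : 𝒴) : ℝ :=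
  p2 x y y - (marginal p2 x y) ^ 2

/-- Cheat-corrected epistemic confidence `C(y|x)`. -/
noncomputable def cheatConf {𝒳 𝒴 : Type*} [Fintype 𝒴] (p2 : 𝒳 → 𝒴 → 𝒴 → ℝ) (x : 𝒳) (y : 𝒴) : ℝ :=
  if 0 < p2 x y y then (marginal p2 x y) ^ 2 / p2 x y y else 0


open MeasureTheory in
theorem measureReal_inter_eq_sum_fibers {Ω ι : Type*} [Fintype ι] [MeasurableSpace Ω]
    (P : Measure Ω) [IsFiniteMeasure P] (g : Ω → ι) (hg : ∀ i, MeasurableSet {ω | g ω = i})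
    {T : Set Ω} (hT : MeasurableSet T) (S : ι → Prop) :
    P.real (T ∩ {ω | S (g ω)}) = ∑ i with S i, P.real (T ∩ {ω | g ω = i}) := by
  rw [← measureReal_biUnion_finset]
  · congr 1
    ext ω
    simp
  · intro i _ j _ hij
    refine Set.disjoint_left.2 ?_
    rintro ω ⟨-, h₁⟩ ⟨-, h₂⟩
    exact hij (h₁.symm.trans h₂)
  · exact fun i _ => hT.inter (hg i)

/-- Chebyshev's inequality for finitely supported weights, with the total weight not normalized. -/
theorem chebyshev_sum_weights {ι : Type*} (s : Finset ι) (w f : ι → ℝ) (m v β : ℝ)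
    (hw : ∀ i ∈ s, 0 ≤ w i) (hm : (∑ i ∈ s, w i) * m = ∑ i ∈ s, w i * f i)
    (hv : (∑ i ∈ s, w i) * v = ∑ i ∈ s, w i * (f i * f i)) (hβ : 0 < β) :
    ∑ i ∈ s with √((v - m ^ 2) / β) < |m - f i|, w i ≤ β * ∑ i ∈ s, w i := by
  have hvar : ∑ i ∈ s, w i * (m - f i) ^ 2 = (∑ i ∈ s, w i) * (v - m ^ 2) := by
    have h : ∀ i, w i * (m - f i) ^ 2 = w i * m ^ 2 - 2 * m * (w i * f i) + w i * (f i * f i) :=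
      fun i => by ring
    simp only [h, sum_add_distrib, sum_sub_distrib, ← sum_mul, ← mul_sum, ← hm, ← hv]
    ring
  have hnn : ∀ i ∈ s, 0 ≤ w i * (m - f i) ^ 2 := fun i hi => mul_nonneg (hw i hi) (sq_nonneg _)
  rcases le_or_gt (v - m ^ 2) 0 with hV | hV
  · have hzero := (sum_eq_zero_iff_of_nonneg hnn).1 <| le_antisymm
      (hvar ▸ mul_nonpos_of_nonneg_of_nonpos (sum_nonneg hw) hV) (sum_nonneg hnn)
    rw [sum_eq_zero]
    · exact mul_nonneg hβ.le (sum_nonneg hw)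
    · intro i hi
      obtain ⟨his, hbad⟩ := mem_filter.1 hi
      have hne : m - f i ≠ 0 := abs_pos.1 ((Real.sqrt_nonneg _).trans_lt hbad)
      simpa [hne] using hzero i his
  · have hle : (∑ i ∈ s with √((v - m ^ 2) / β) < |m - f i|, w i) * ((v - m ^ 2) / β)
        ≤ (∑ i ∈ s, w i) * (v - m ^ 2) := by
      rw [← hvar, sum_mul]
      refine (sum_le_sum fun i hi => ?_).trans
        (sum_le_sum_of_subset_of_nonneg (filter_subset _ s) fun i hi _ => hnn i hi)
      obtain ⟨his, hbad⟩ := mem_filter.1 hi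
      refine mul_le_mul_of_nonneg_left ?_ (hw i his)
      rw [← sq_abs (m - f i)]
      exact (Real.sqrt_le_left (abs_nonneg _)).1 hbad.le
    rw [mul_div_assoc', div_le_iff₀ hβ] at hle
    exact le_of_mul_le_mul_right (by linarith) hV

section Calibration

variable {𝒳 𝒴 𝒵 : Type*} [Fintype 𝒳]

theorem groupExp_congr (μ : 𝒳 → ℝ) (Φ : 𝒳 → 𝒵) (f : 𝒳 → ℝ) {x x' : 𝒳} (h : Φ x = Φ x') :
    groupExp μ Φ f x = groupExp μ Φ f x' := by
  simp only [groupExp, h]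

theorem sum_mul_groupExp {μ : 𝒳 → ℝ} (hμ : ∀ x, 0 < μ x) (Φ : 𝒳 → 𝒵) (f : 𝒳 → ℝ) (x : 𝒳) :
    (∑ x' with Φ x' = Φ x, μ x') * groupExp μ Φ f x = ∑ x' with Φ x' = Φ x, μ x' * f x' := by
  have hpos : 0 < ∑ x' with Φ x' = Φ x, μ x' :=
    sum_pos (fun i _ => hμ i) ⟨x, by simp⟩
  rw [groupExp, ← sum_filter, ← sum_filter, mul_div_cancel₀ _ hpos.ne']

theorem groupExp_sum [Fintype 𝒴] (μ : 𝒳 → ℝ) (Φ : 𝒳 → 𝒵) (f : 𝒴 → 𝒳 → ℝ) (x : 𝒳) :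
    ∑ y, groupExp μ Φ (f y) x = groupExp μ Φ (fun x' => ∑ y, f y x') x := by
  simp only [groupExp, ← sum_filter, ← sum_div, mul_sum]
  rw [sum_comm]

theorem marginal_eq_groupExp [Fintype 𝒴] {μ : 𝒳 → ℝ} {Φ : 𝒳 → 𝒵} {p : 𝒳 → 𝒴 → ℝ}
    {p2 : 𝒳 → 𝒴 → 𝒴 → ℝ} (hp1 : ∀ x, ∑ y, p x y = 1)
    (hcal : ∀ x y₁ y₂, p2 x y₁ y₂ = groupExp μ Φ (fun x' => p x' y₁ * p x' y₂) x)
    (x : 𝒳) (y : 𝒴) : marginal p2 x y = groupExp μ Φ (fun x' => p x' y) x := by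
  simp only [marginal, hcal, groupExp_sum, ← mul_sum, hp1, mul_one]

/-- The confidence bound for a fixed response, for weights proportional to `μ` on each group. -/
theorem sum_bad_le [Fintype 𝒴] {μ : 𝒳 → ℝ} (hμ : ∀ x, 0 < μ x) {Φ : 𝒳 → 𝒵} {p : 𝒳 → 𝒴 → ℝ}
    {p2 : 𝒳 → 𝒴 → 𝒴 → ℝ} (hp1 : ∀ x, ∑ y, p x y = 1)
    (hcal : ∀ x y₁ y₂, p2 x y₁ y₂ = groupExp μ Φ (fun x' => p x' y₁ * p x' y₂) x)
    (y : 𝒴) {q : 𝒳 → ℝ} (hq : ∀ x, 0 ≤ q x)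
    (hqμ : ∀ x, q x * ∑ x' with Φ x' = Φ x, μ x' = (∑ x' with Φ x' = Φ x, q x') * μ x)
    {β : ℝ} (hβ : 0 < β) :
    ∑ x with √(cheatVar p2 x y / β) < |marginal p2 x y - p x y|, q x ≤ β * ∑ x, q x := by
  have hmaps : ∀ x ∈ (univ : Finset 𝒳), Φ x ∈ univ.image Φ :=
    fun x hx => mem_image_of_mem Φ hx
  rw [sum_filter, ← sum_fiberwise_of_maps_to hmaps q, ← sum_fiberwise_of_maps_to hmaps, mul_sum]
  refine sum_le_sum fun z hz => ?_
  obtain ⟨x₀, -, rfl⟩ := mem_image.1 hz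
  set M := ∑ x' with Φ x' = Φ x₀, μ x'
  set Q := ∑ x' with Φ x' = Φ x₀, q x'
  have hM : 0 < M := sum_pos (fun i _ => hμ i) ⟨x₀, by simp⟩
  have hprop : ∀ x, Φ x = Φ x₀ → q x = Q / M * μ x := fun x hx => by
    have h := hqμ x
    rw [hx] at h
    rw [div_mul_eq_mul_div, eq_div_iff hM.ne']
    exact h
  have hmean : ∀ f : 𝒳 → ℝ,
      Q * groupExp μ Φ f x₀ = ∑ x with Φ x = Φ x₀, q x * f x := fun f => by
    rw [sum_congr rfl fun x hx => by rw [hprop x (mem_filter.1 hx).2, mul_assoc], ← mul_sum,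
      ← sum_mul_groupExp hμ, ← mul_assoc, div_mul_cancel₀ _ hM.ne']
  have key := chebyshev_sum_weights _ q (fun x => p x y) _ _ β (fun x _ => hq x)
    (hmean fun x => p x y) (hmean fun x => p x y * p x y) hβ
  rw [sum_filter] at key
  refine le_trans (le_of_eq (sum_congr rfl fun x hx => ?_)) key
  have hx := (mem_filter.1 hx).2
  rw [cheatVar, marginal_eq_groupExp hp1 hcal, hcal, groupExp_congr _ _ _ hx,
    groupExp_congr _ _ (fun x' => p x' y) hx]

end Calibration

/-- Chebyshev-style confidence interval for the true conditional
probability, conditioned on the event `A` that a decoding algorithm responds. -/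
theorem stmt_8 {𝒳 𝒴 𝒵 : Type*} [Fintype 𝒳] [Fintype 𝒴] [Nonempty 𝒳] [Nonempty 𝒴]
    (μ : 𝒳 → ℝ) (hμpos : ∀ x, 0 < μ x) (hμsum : ∑ x, μ x = 1)
    (p : 𝒳 → 𝒴 → ℝ) (hp0 : ∀ x y, 0 ≤ p x y) (hp1 : ∀ x, ∑ y, p x y = 1)
    (p2 : 𝒳 → 𝒴 → 𝒴 → ℝ)
    (hp20 : ∀ x y₁ y₂, 0 ≤ p2 x y₁ y₂) (hp21 : ∀ x, ∑ y₁, ∑ y₂, p2 x y₁ y₂ = 1)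
    (Φ : 𝒳 → 𝒵)
    (hcal : ∀ x y₁ y₂, p2 x y₁ y₂ = groupExp μ Φ (fun x' => p x' y₁ * p x' y₂) x)
    {Ω : Type*} [MeasurableSpace Ω] (P : MeasureTheory.Measure Ω)
    [MeasureTheory.IsProbabilityMeasure P]
    (X : Ω → 𝒳) (Yt : Ω → 𝒴) (A : Set Ω)
    (hA : MeasurableSet A) (hXm : ∀ x, MeasurableSet {ω | X ω = x})
    (hYm : ∀ y, MeasurableSet {ω | Yt ω = y})
    (hPA : 0 < P A)
    (hdist : ∀ x, P {ω | X ω = x} = ENNReal.ofReal (μ x))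
    (hCI : ∀ (x : 𝒳) (y : 𝒴),
      P ({ω | Yt ω = y} ∩ A ∩ {ω | X ω = x}) * P {ω | Φ (X ω) = Φ x}
        = P ({ω | Yt ω = y} ∩ A ∩ {ω | Φ (X ω) = Φ x}) * P {ω | X ω = x}) :
    ∀ β : ℝ, 0 < β → β < 1 →
      (P (A ∩ {ω | Real.sqrt (cheatVar p2 (X ω) (Yt ω) / β)
          < |marginal p2 (X ω) (Yt ω) - p (X ω) (Yt ω)|})).toReal / (P A).toReal ≤ β := by
  intro β hβ _
  have hreal : ∀ x, P.real {ω | X ω = x} = μ x := fun x => by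
    rw [MeasureTheory.measureReal_def, hdist, ENNReal.toReal_ofReal (hμpos x).le]
  have hYA : ∀ y, MeasurableSet ({ω | Yt ω = y} ∩ A) := fun y => (hYm y).inter hA
  have hprop : ∀ y x,
      P.real ({ω | Yt ω = y} ∩ A ∩ {ω | X ω = x}) * ∑ x' with Φ x' = Φ x, μ x'
        = (∑ x' with Φ x' = Φ x, P.real ({ω | Yt ω = y} ∩ A ∩ {ω | X ω = x'})) * μ x := by
    intro y x
    have hgroup : P.real {ω | Φ (X ω) = Φ x} = ∑ x' with Φ x' = Φ x, μ x' := by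
      simpa [hreal] using
        measureReal_inter_eq_sum_fibers P X hXm MeasurableSet.univ (fun x' => Φ x' = Φ x)
    rw [← hgroup, ← hreal x,
      ← measureReal_inter_eq_sum_fibers P X hXm (hYA y) (fun x' => Φ x' = Φ x)]
    simpa [MeasureTheory.measureReal_def] using congrArg ENNReal.toReal (hCI x y)
  have hsplit : ∀ S : 𝒳 → 𝒴 → Prop, P.real (A ∩ {ω | S (X ω) (Yt ω)})
      = ∑ y, ∑ x with S x y, P.real ({ω | Yt ω = y} ∩ A ∩ {ω | X ω = x}) := by
    intro S
    have hfib : ∀ i : 𝒴 × 𝒳, {ω | (Yt ω, X ω) = i} = {ω | Yt ω = i.1} ∩ {ω | X ω = i.2} :=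
      fun i => by ext ω; simp [Prod.ext_iff]
    rw [measureReal_inter_eq_sum_fibers P (fun ω => (Yt ω, X ω))
      (fun i => hfib i ▸ (hYm i.1).inter (hXm i.2)) hA (fun i => S i.2 i.1), sum_filter,
      Fintype.sum_prod_type]
    simp only [hfib, sum_filter, Set.inter_right_comm _ A, Set.inter_comm A]
  have htotal : P.real A = ∑ y, ∑ x, P.real ({ω | Yt ω = y} ∩ A ∩ {ω | X ω = x}) := by
    simpa using hsplit fun _ _ => True
  have hAreal : 0 < P.real A := ENNReal.toReal_pos hPA.ne' (MeasureTheory.measure_ne_top P A)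
  simp only [← MeasureTheory.measureReal_def]
  rw [div_le_iff₀ hAreal,
    hsplit fun x y => √(cheatVar p2 x y / β) < |marginal p2 x y - p x y|, htotal, mul_sum]
  exact sum_le_sum fun y _ => sum_bad_le hμpos hp1 hcal y
    (fun _ => MeasureTheory.measureReal_nonneg) (hprop y) hβ
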